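/- arXiv:2011.00706 — 3 statements merged into one kernel-verified Lean document; each statement's English description precedes it below -/
import Mathlib

section
/- For every a, b ∈ Z_{2n−1} and every π ∈ M_{2n,k}, the permutation φ(a,b,π) is again an element of M_{2n,k}. -/
/-- The representative of `x : ZMod n` in `{1, …, n}` (so `0` represents `n`). -/
def repr1 (n : ℕ) (x : ZMod n) : ℕ := if x = 0 then n else x.val

/-- Values of `ZMod n`, embedded into `ZMod (n+1)` via representatives in `{1, …, n}`. -/
def emb (n : ℕ) (x : ZMod n) : ZMod (n + 1) := (repr1 n x : ZMod (n + 1))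

/-- `L 0 = 0` and `L i = π(i)` for `i ∈ {1,…,n}`: the listing used to build
the cycle `Y_π = (π(n) π(n−1) … π(1) 0)`. -/
def listFun (n : ℕ) (π : Equiv.Perm (ZMod n)) : ZMod (n + 1) → ZMod (n + 1) :=
  fun i => if i = 0 then 0 else emb n (π (i.val : ZMod n))

/-- The inverse listing of `listFun`. -/
def listInv (n : ℕ) (π : Equiv.Perm (ZMod n)) : ZMod (n + 1) → ZMod (n + 1) :=
  fun y => if y = 0 then 0 else emb n (π.symm (y.val : ZMod n))

/-- The cycle `Y_π = (π(n) π(n−1) … π(1) 0)` on `{0,1,…,n}`, as a function: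
it sends `L(i)` to `L(i-1)`. -/
def Yfun (n : ℕ) (π : Equiv.Perm (ZMod n)) : ZMod (n + 1) → ZMod (n + 1) :=
  fun y => listFun n π (listInv n π y - 1)

/-- `C_π = Y_π ∘ X_n`, where `X_n` is the cycle `(0 1 2 … n)`, i.e. `x ↦ x + 1`. -/
def Cfun (n : ℕ) (π : Equiv.Perm (ZMod n)) : ZMod (n + 1) → ZMod (n + 1) :=
  fun x => Yfun n π (x + 1)

/-- The strategic pile of `π ∈ S_n`: the set of values appearing strictly after `n` and
strictly before `0` on the cycle of `C_π` containing `0` and `n` (empty if `0` and `n`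
lie in different cycles). -/
def strategicPile (n : ℕ) (π : Equiv.Perm (ZMod n)) : Set (ZMod (n + 1)) :=
  {x | ∃ k m : ℕ, 0 < k ∧ k < m ∧ (Cfun n π)^[m] (n : ZMod (n + 1)) = 0 ∧
      (∀ j, 0 < j → j < m → (Cfun n π)^[j] (n : ZMod (n + 1)) ≠ 0) ∧
      (Cfun n π)^[k] (n : ZMod (n + 1)) = x}

/-- `π ∈ S_n` has maximal strategic pile. -/
def MaxPile (n : ℕ) (π : Equiv.Perm (ZMod n)) : Prop :=
  (Even n ∧ (strategicPile n π).ncard = n - 1) ∨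
  (Odd n ∧ (strategicPile n π).ncard = n - 2)

/-- The position (in `{1,…,n}`) of the value `v` in `π`. -/
def idx (n : ℕ) (π : Equiv.Perm (ZMod n)) (v : ZMod n) : ℕ := repr1 n (π.symm v)

/-- Word coordinate of the occurrence of the pointer `(p,p+1)` as the right pointer of the
entry `p`:  the entry at position `i` is given word coordinate `3*i - 1`, its left pointer
coordinate `3*i - 2` and its right pointer coordinate `3*i`. -/
def posR (n : ℕ) (π : Equiv.Perm (ZMod n)) (p : ZMod n) : ℕ := 3 * idx n π p

/-- Word coordinate of the occurrence of the pointer `(p,p+1)` as the left pointer of the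
entry `p+1`. -/
def posL (n : ℕ) (π : Equiv.Perm (ZMod n)) (p : ZMod n) : ℕ := 3 * idx n π (p + 1) - 2

/-- Two pairs of positions interleave (pattern `a b a b` or `b a b a`). -/
def Interleaved (a1 a2 b1 b2 : ℕ) : Prop :=
  (min a1 a2 < min b1 b2 ∧ min b1 b2 < max a1 a2 ∧ max a1 a2 < max b1 b2) ∨
  (min b1 b2 < min a1 a2 ∧ min a1 a2 < max b1 b2 ∧ max b1 b2 < max a1 a2)

/-- `(p, q)` is a valid pointer context for `π`: the two pointers are distinct and their
occurrences in the pointer word of `π` appear in the order `p,q,p,q` or `q,p,q,p`. -/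
def ValidContext (n : ℕ) (π : Equiv.Perm (ZMod n)) (p q : ZMod n) : Prop :=
  p ≠ q ∧ Interleaved (posR n π p) (posL n π p) (posR n π q) (posL n π q)

/-- The number of (unordered) valid pointer contexts of `π`. -/
noncomputable def numContexts (n : ℕ) (π : Equiv.Perm (ZMod n)) : ℕ :=
  {pq : ZMod n × ZMod n | ValidContext n π pq.1 pq.2}.ncard / 2

/-- `ρ ∈ S_{2n−1}` is the contraction of `π ∈ S_{2n}`, obtained by deleting the entry `2n`. -/
def IsContraction (n : ℕ) (ρ : Equiv.Perm (ZMod (2 * n - 1)))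
    (π : Equiv.Perm (ZMod (2 * n))) : Prop :=
  ∃ m : ℕ, 1 ≤ m ∧ m ≤ 2 * n ∧ π (m : ZMod (2 * n)) = ((2 * n : ℕ) : ZMod (2 * n)) ∧
    (∀ k : ℕ, 1 ≤ k → k < m →
      ρ (k : ZMod (2 * n - 1)) =
        ((repr1 (2 * n) (π (k : ZMod (2 * n))) : ℕ) : ZMod (2 * n - 1))) ∧
    (∀ k : ℕ, m ≤ k → k ≤ 2 * n - 1 →
      ρ (k : ZMod (2 * n - 1)) =
        ((repr1 (2 * n) (π ((k + 1 : ℕ) : ZMod (2 * n))) : ℕ) : ZMod (2 * n - 1)))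

/-- `M_{2n}`: the contractions of permutations in `S_{2n}` with maximal strategic pile. -/
def MsetAll (n : ℕ) : Set (Equiv.Perm (ZMod (2 * n - 1))) :=
  {ρ | ∃ π : Equiv.Perm (ZMod (2 * n)), MaxPile (2 * n) π ∧ IsContraction n ρ π}

/-- `M_{2n,k}`: the contractions of permutations in `S_{2n}` with maximal strategic pile
and exactly `k` valid pointer contexts. -/
def Mset (n k : ℕ) : Set (Equiv.Perm (ZMod (2 * n - 1))) :=
  {ρ | ρ ∈ MsetAll n ∧ numContexts (2 * n - 1) ρ = k}

/-- Cyclic shift by `a`: `C_a(π)(x) = π(x - a)`. -/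
def Cshift (n : ℕ) (a : ZMod n) (π : Equiv.Perm (ZMod n)) : Equiv.Perm (ZMod n) :=
  (Equiv.subRight a).trans π

/-- Translation by `b`: `T_b(π)(x) = π(x) + b`. -/
def Tshift (n : ℕ) (b : ZMod n) (π : Equiv.Perm (ZMod n)) : Equiv.Perm (ZMod n) :=
  π.trans (Equiv.addRight b)

/-- `φ(a,b,π) = C_a(T_b(π))`, i.e. `x ↦ π(x-a) + b`. -/
def phiAct (n : ℕ) (a b : ZMod n) (π : Equiv.Perm (ZMod n)) : Equiv.Perm (ZMod n) :=
  Cshift n a (Tshift n b π)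

/-- The difference sequence of `π`. -/
def Dseq (n : ℕ) (π : Equiv.Perm (ZMod n)) : ZMod n → ZMod n :=
  fun k => π (k + 1) - π k

/-- The difference sequence of `π` is periodic with (least) period `p`, `0 < p < n`. -/
def PeriodicWith (n : ℕ) (π : Equiv.Perm (ZMod n)) (p : ℕ) : Prop :=
  0 < p ∧ p < n ∧ (∀ k : ZMod n, Dseq n π (k + (p : ZMod n)) = Dseq n π k) ∧
    ∀ q : ℕ, 0 < q → q < p → ¬ ∀ k : ZMod n, Dseq n π (k + (q : ZMod n)) = Dseq n π k

theorem repr1_pos {n : ℕ} [NeZero n] (x : ZMod n) : 1 ≤ repr1 n x := by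
  unfold repr1
  split_ifs with h
  · exact Nat.pos_of_neZero n
  · exact Nat.pos_of_ne_zero ((ZMod.val_ne_zero x).2 h)

theorem repr1_le {n : ℕ} [NeZero n] (x : ZMod n) : repr1 n x ≤ n := by
  unfold repr1
  split_ifs with h
  · exact le_rfl
  · exact (ZMod.val_lt x).le

theorem cast_repr1 {n : ℕ} [NeZero n] (x : ZMod n) : (repr1 n x : ZMod n) = x := by
  unfold repr1
  split_ifs with h
  · simp [h]
  · simp

theorem repr1_injective (n : ℕ) [NeZero n] : Function.Injective (repr1 n) := fun x y h => by
  rw [← cast_repr1 x, h, cast_repr1]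

theorem repr1_natCast {n i : ℕ} (h1 : 1 ≤ i) (h2 : i ≤ n) : repr1 n (i : ZMod n) = i := by
  unfold repr1
  rcases h2.eq_or_lt with rfl | h2
  · simp
  · have : (i : ZMod n).val = i := ZMod.val_natCast_of_lt h2
    rw [if_neg, this]
    intro h
    rw [h, ZMod.val_zero] at this
    omega

theorem repr1_add {n : ℕ} [NeZero n] (x a : ZMod n) :
    repr1 n (x + a) = repr1 n x + a.val ∨ repr1 n (x + a) + n = repr1 n x + a.val := by
  have hx := repr1_pos x
  have hx' := repr1_le x
  have ha := ZMod.val_lt a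
  have e : x + a = ((repr1 n x + a.val : ℕ) : ZMod n) := by
    push_cast
    rw [cast_repr1, ZMod.natCast_zmod_val]
  rcases le_or_gt (repr1 n x + a.val) n with h | h
  · left
    rw [e, repr1_natCast (by omega) h]
  · right
    have e' : x + a = ((repr1 n x + a.val - n : ℕ) : ZMod n) := by
      rw [e, Nat.cast_sub h.le, ZMod.natCast_self, sub_zero]
    rw [e', repr1_natCast (by omega) (by omega)]
    omega

theorem natCast_injOn {n i j : ℕ} (hi : i < n) (hj : j < n)
    (h : (i : ZMod n) = (j : ZMod n)) : i = j := by
  have := congrArg ZMod.val h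
  rwa [ZMod.val_natCast_of_lt hi, ZMod.val_natCast_of_lt hj] at this

theorem emb_injective (n : ℕ) [NeZero n] : Function.Injective (emb n) := fun x y h =>
  repr1_injective n (natCast_injOn (Nat.lt_succ_of_le (repr1_le x))
    (Nat.lt_succ_of_le (repr1_le y)) h)

theorem emb_ne_zero {n : ℕ} [NeZero n] (x : ZMod n) : emb n x ≠ 0 := fun h => by
  have h1 := repr1_pos x
  have := natCast_injOn (Nat.lt_succ_of_le (repr1_le x)) (Nat.succ_pos n)
    (h.trans Nat.cast_zero.symm)
  omega

theorem emb_val {n : ℕ} [NeZero n] (x : ZMod n) : (emb n x).val = repr1 n x :=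
  ZMod.val_natCast_of_lt (Nat.lt_succ_of_le (repr1_le x))

theorem emb_natCast {n i : ℕ} (h1 : 1 ≤ i) (h2 : i ≤ n) :
    emb n (i : ZMod n) = (i : ZMod (n + 1)) := by
  rw [emb, repr1_natCast h1 h2]

theorem listFun_zero (n : ℕ) (π : Equiv.Perm (ZMod n)) : listFun n π 0 = 0 := by
  simp [listFun]

theorem listFun_natCast {n i : ℕ} (π : Equiv.Perm (ZMod n)) (h1 : 1 ≤ i) (h2 : i ≤ n) :
    listFun n π (i : ZMod (n + 1)) = emb n (π i) := by
  have hv : (i : ZMod (n + 1)).val = i := ZMod.val_natCast_of_lt (Nat.lt_succ_of_le h2)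
  have h0 : (i : ZMod (n + 1)) ≠ 0 := fun h => by
    rw [h, ZMod.val_zero] at hv
    omega
  rw [listFun, if_neg h0, hv]

theorem eq_zero_or_emb {n : ℕ} [NeZero n] (y : ZMod (n + 1)) : y = 0 ∨ ∃ x, y = emb n x := by
  by_cases h : y = 0
  · exact .inl h
  · refine .inr ⟨(y.val : ZMod n), ?_⟩
    rw [emb_natCast (Nat.pos_of_ne_zero ((ZMod.val_ne_zero y).2 h))
      (Nat.lt_succ_iff.1 (ZMod.val_lt y)), ZMod.natCast_zmod_val]

theorem listFun_emb {n : ℕ} [NeZero n] (π : Equiv.Perm (ZMod n)) (x : ZMod n) :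
    listFun n π (emb n x) = emb n (π x) := by
  rw [listFun, if_neg (emb_ne_zero x), emb_val, cast_repr1]

theorem listInv_emb {n : ℕ} [NeZero n] (π : Equiv.Perm (ZMod n)) (x : ZMod n) :
    listInv n π (emb n x) = emb n (π.symm x) := by
  rw [listInv, if_neg (emb_ne_zero x), emb_val, cast_repr1]

theorem listInv_listFun {n : ℕ} [NeZero n] (π : Equiv.Perm (ZMod n)) (y : ZMod (n + 1)) :
    listInv n π (listFun n π y) = y := by
  rcases eq_zero_or_emb y with rfl | ⟨x, rfl⟩
  · simp [listFun, listInv]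
  · rw [listFun_emb, listInv_emb, π.symm_apply_apply]

theorem listFun_injective {n : ℕ} [NeZero n] (π : Equiv.Perm (ZMod n)) :
    Function.Injective (listFun n π) :=
  Function.LeftInverse.injective (listInv_listFun π)

theorem listFun_surjective {n : ℕ} [NeZero n] (π : Equiv.Perm (ZMod n)) :
    Function.Surjective (listFun n π) :=
  Finite.surjective_of_injective (listFun_injective π)

theorem Cfun_listFun_sub_one {n : ℕ} [NeZero n] (π : Equiv.Perm (ZMod n)) (y : ZMod (n + 1)) :
    Cfun n π (listFun n π y - 1) = listFun n π (y - 1) := by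
  rw [Cfun, sub_add_cancel, Yfun, listInv_listFun]

theorem Cfun_surjective {n : ℕ} [NeZero n] (π : Equiv.Perm (ZMod n)) :
    Function.Surjective (Cfun n π) := fun y => by
  obtain ⟨j, rfl⟩ := listFun_surjective π y
  exact ⟨listFun n π (j + 1) - 1, by rw [Cfun_listFun_sub_one, add_sub_cancel_right]⟩

theorem Cfun_injective {n : ℕ} [NeZero n] (π : Equiv.Perm (ZMod n)) :
    Function.Injective (Cfun n π) :=
  Finite.injective_iff_surjective.2 (Cfun_surjective π)

theorem natCast_self_succ_ne_zero {n : ℕ} [NeZero n] : (n : ZMod (n + 1)) ≠ 0 := fun h =>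
  NeZero.ne n (natCast_injOn (Nat.lt_succ_self n) (Nat.succ_pos n) (h.trans Nat.cast_zero.symm))

theorem natCast_self_succ {n : ℕ} : (n : ZMod (n + 1)) = -1 := by
  rw [eq_neg_iff_add_eq_zero]
  exact_mod_cast ZMod.natCast_self (n + 1)

/-- A self-map is a single cycle (on a finite type) when it has no proper nonempty invariant
subset. -/
def IsTransitiveMap {α : Type*} (f : α → α) : Prop :=
  ∀ S : Set α, S.Nonempty → Set.MapsTo f S S → S = Set.univ

theorem isTransitiveMap_conj {α β : Type*} (e : α ≃ β) {f : α → α} {g : β → β}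
    (h : ∀ x, g (e x) = e (f x)) (hf : IsTransitiveMap f) : IsTransitiveMap g := by
  intro S ⟨s, hs⟩ hS
  have := hf (e ⁻¹' S) ⟨e.symm s, by simpa using hs⟩ fun x hx => by
    rw [Set.mem_preimage, ← h]
    exact hS hx
  rw [Set.eq_univ_iff_forall] at this ⊢
  intro y
  simpa using this (e.symm y)

/-- The strategic pile has size `n - 1` exactly when `C_π` is a full cycle sending `0` to `n`. -/
theorem ncard_strategicPile_eq_iff {n : ℕ} (hn : 2 ≤ n) (π : Equiv.Perm (ZMod n)) :
    (strategicPile n π).ncard = n - 1 ↔ Cfun n π 0 = n ∧ IsTransitiveMap (Cfun n π) := by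
  have : NeZero n := ⟨by omega⟩
  set C := Cfun n π with hC
  have hinj : Function.Injective C := Cfun_injective π
  constructor
  · intro h
    have hne : (strategicPile n π).Nonempty := by
      rw [← Set.ncard_pos (Set.toFinite _)]
      omega
    obtain ⟨-, -, m, -, -, hm0, hmin, -⟩ := hne
    have hm0' := hm0
    obtain ⟨m0, hm⟩ : ∃ m', m = m' + 1 := by
      refine ⟨m - 1, ?_⟩
      rcases m with _ | m
      · exact absurd hm0 natCast_self_succ_ne_zero
      · rfl
    have hdist : ∀ i j, i < j → j ≤ m → C^[i] (n : ZMod (n + 1)) ≠ C^[j] (n : ZMod (n + 1)) := by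
      intro i j hij hj he
      have : C^[m - (j - i)] (n : ZMod (n + 1)) = 0 := by
        rw [← hm0, show m - (j - i) = (m - j) + i by omega, Function.iterate_add_apply, he,
          ← Function.iterate_add_apply, Nat.sub_add_cancel hj]
      rcases Nat.eq_zero_or_pos (m - (j - i)) with h0 | h0
      · rw [h0] at this
        exact natCast_self_succ_ne_zero this
      · exact hmin _ h0 (by omega) this
    have hinjOn : Set.InjOn (fun i => C^[i] (n : ZMod (n + 1))) (Finset.range (m + 1)) := by
      intro i hi j hj he
      simp only [Finset.coe_range, Set.mem_Iio] at hi hj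
      by_contra hij
      rcases Nat.lt_or_gt_of_ne hij with hij | hij
      · exact hdist i j hij (by omega) he
      · exact hdist j i hij (by omega) he.symm
    have hle : n ≤ m := by
      have hsub : strategicPile n π ⊆
          ((Finset.Ioo 0 m).image (fun i => C^[i] (n : ZMod (n + 1))) : Finset _) := by
        rintro x ⟨k, m', hk, hkm, hm', hmin', rfl⟩
        have : m' = m := by
          rcases lt_trichotomy m' m with h1 | h1 | h1
          · exact absurd hm' (hmin _ (by omega) h1)
          · exact h1
          · exact absurd hm0 (hmin' _ (by omega) h1)
        subst this
        simp only [Finset.coe_image, Finset.coe_Ioo]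
        exact ⟨k, ⟨hk, hkm⟩, rfl⟩
      have := Set.ncard_le_ncard hsub (Finset.finite_toSet _)
      rw [Set.ncard_coe_finset] at this
      have h2 := this.trans Finset.card_image_le
      rw [Nat.card_Ioo] at h2
      omega
    have huniv : (Finset.range (m + 1)).image (fun i => C^[i] (n : ZMod (n + 1))) = Finset.univ := by
      rw [← Finset.card_eq_iff_eq_univ]
      apply le_antisymm (Finset.card_le_univ _)
      rw [Finset.card_image_of_injOn hinjOn, ZMod.card, Finset.card_range]
      omega
    have hall : ∀ x, ∃ i ≤ m, C^[i] (n : ZMod (n + 1)) = x := fun x => by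
      have := Finset.mem_univ x
      rw [← huniv, Finset.mem_image] at this
      obtain ⟨i, hi, he⟩ := this
      exact ⟨i, by simpa [Nat.lt_succ_iff] using hi, he⟩
    have hC0 : C 0 = n := by
      obtain ⟨y, hy⟩ := Cfun_surjective π n
      obtain ⟨i, hi, rfl⟩ := hall y
      rw [← hC, ← Function.iterate_succ_apply' C] at hy
      rcases hi.eq_or_lt with rfl | hi
      · rwa [Function.iterate_succ_apply', hm0'] at hy
      · exact absurd hy.symm (hdist 0 (i + 1) (by omega) (by omega))
    refine ⟨hC0, fun S ⟨s, hs⟩ hS => ?_⟩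
    obtain ⟨i, hi, rfl⟩ := hall s
    have h0 : (0 : ZMod (n + 1)) ∈ S := by
      rw [← hm0, ← Nat.sub_add_cancel hi, Function.iterate_add_apply]
      exact hS.iterate _ hs
    have hnS : (n : ZMod (n + 1)) ∈ S := hC0 ▸ hS h0
    rw [Set.eq_univ_iff_forall]
    intro x
    obtain ⟨j, -, rfl⟩ := hall x
    exact hS.iterate _ hnS
  · rintro ⟨hC0, htr⟩
    have hex : ∃ m, C^[m] (n : ZMod (n + 1)) = 0 := by
      have := htr (Set.range fun m => C^[m] (n : ZMod (n + 1))) ⟨_, 0, rfl⟩ (by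
        rintro _ ⟨m, rfl⟩
        exact ⟨m + 1, Function.iterate_succ_apply' C m _⟩)
      exact Set.eq_univ_iff_forall.1 this 0
    classical
    obtain ⟨m, hm0, hmin⟩ : ∃ m, C^[m] (n : ZMod (n + 1)) = 0 ∧
        ∀ j < m, C^[j] (n : ZMod (n + 1)) ≠ 0 :=
      ⟨Nat.find hex, Nat.find_spec hex, fun j hj => Nat.find_min hex hj⟩
    have hall : ∀ x, ∃ i ≤ m, C^[i] (n : ZMod (n + 1)) = x := by
      have := htr {x | ∃ i ≤ m, C^[i] (n : ZMod (n + 1)) = x} ⟨_, 0, Nat.zero_le _, rfl⟩ (by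
        rintro _ ⟨i, hi, rfl⟩
        rcases hi.eq_or_lt with rfl | hi
        · exact ⟨0, Nat.zero_le _, by rw [hm0, hC0]; rfl⟩
        · exact ⟨i + 1, hi, Function.iterate_succ_apply' C i _⟩)
      exact Set.eq_univ_iff_forall.1 this
    have hSP : strategicPile n π = (({0, (n : ZMod (n + 1))} : Finset (ZMod (n + 1)))ᶜ :
        Finset _) := by
      ext x
      simp only [Finset.coe_compl, Finset.coe_insert, Finset.coe_singleton, Set.mem_compl_iff,
        Set.mem_insert_iff, Set.mem_singleton_iff, not_or]
      constructor
      · rintro ⟨k, m', hk, hkm, hm', hmin', rfl⟩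
        refine ⟨hmin' k hk hkm, fun he => ?_⟩
        apply hmin' (m' - k) (by omega) (by omega)
        rw [← hC] at he hm' ⊢
        nth_rewrite 1 [← he]
        rw [← Function.iterate_add_apply, Nat.sub_add_cancel hkm.le, hm']
      · rintro ⟨h0, hn'⟩
        obtain ⟨i, hi, rfl⟩ := hall x
        refine ⟨i, m, Nat.pos_of_ne_zero ?_, lt_of_le_of_ne hi ?_, hm0,
          fun j _ hj => hmin j hj, rfl⟩
        · rintro rfl
          exact hn' rfl
        · rintro rfl
          exact h0 hm0
    rw [hSP, Set.ncard_coe_finset, Finset.card_compl, ZMod.card,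
      Finset.card_pair natCast_self_succ_ne_zero.symm]
    omega

theorem maxPile_iff {n : ℕ} (hn : 2 ≤ n) (he : Even n) (π : Equiv.Perm (ZMod n)) :
    MaxPile n π ↔ Cfun n π 0 = n ∧ IsTransitiveMap (Cfun n π) := by
  rw [← ncard_strategicPile_eq_iff hn, MaxPile]
  have := Nat.not_odd_iff_even.2 he
  tauto
theorem interleaved_iff {a₁ a₂ b₁ b₂ : ℕ} (h₁₁ : a₁ ≠ b₁) (h₁₂ : a₁ ≠ b₂) (h₂₁ : a₂ ≠ b₁)
    (h₂₂ : a₂ ≠ b₂) :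
    Interleaved a₁ a₂ b₁ b₂ ↔ ¬ (((a₁ < b₁) ↔ (a₂ < b₁)) ↔ ((a₁ < b₂) ↔ (a₂ < b₂))) := by
  unfold Interleaved
  rcases le_total a₁ a₂ with h | h <;> rcases le_total b₁ b₂ with h' | h' <;>
    simp only [h, h', min_eq_left, min_eq_right, max_eq_left, max_eq_right] <;> omega

theorem interleaved_shift {a₁ a₂ b₁ b₂ a₁' a₂' b₁' b₂' : ℕ} {w₁ w₂ v₁ v₂ : Prop}
    (h₁₁ : a₁ ≠ b₁) (h₁₂ : a₁ ≠ b₂) (h₂₁ : a₂ ≠ b₁) (h₂₂ : a₂ ≠ b₂)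
    (k₁₁ : a₁' ≠ b₁') (k₁₂ : a₁' ≠ b₂') (k₂₁ : a₂' ≠ b₁') (k₂₂ : a₂' ≠ b₂')
    (l₁₁ : (a₁' < b₁') ↔ ((a₁ < b₁) ↔ (w₁ ↔ v₁)))
    (l₁₂ : (a₁' < b₂') ↔ ((a₁ < b₂) ↔ (w₁ ↔ v₂)))
    (l₂₁ : (a₂' < b₁') ↔ ((a₂ < b₁) ↔ (w₂ ↔ v₁)))
    (l₂₂ : (a₂' < b₂') ↔ ((a₂ < b₂) ↔ (w₂ ↔ v₂))) :
    Interleaved a₁' a₂' b₁' b₂' ↔ Interleaved a₁ a₂ b₁ b₂ := by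
  rw [interleaved_iff h₁₁ h₁₂ h₂₁ h₂₂, interleaved_iff k₁₁ k₁₂ k₂₁ k₂₂, l₁₁, l₁₂, l₂₁, l₂₂]
  generalize (a₁ < b₁) = P, (a₁ < b₂) = Q, (a₂ < b₁) = R, (a₂ < b₂) = S
  by_cases w₁ <;> by_cases w₂ <;> by_cases v₁ <;> by_cases v₂ <;> by_cases P <;> by_cases Q <;>
    by_cases R <;> by_cases S <;> simp only [*, iff_true, iff_false, not_true, not_false_iff]

theorem validContext_phiAct {n : ℕ} [NeZero n] (a b : ZMod n) (π : Equiv.Perm (ZMod n))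
    (p q : ZMod n) :
    ValidContext n (phiAct n a b π) p q ↔ ValidContext n π (p - b) (q - b) := by
  have hidx : ∀ v, idx n (phiAct n a b π) v = repr1 n (π.symm (v - b) + a) := fun v => by
    simp [idx, phiAct, Cshift, Tshift, sub_eq_add_neg]
  have hidx' : ∀ v, idx n π v = repr1 n (π.symm v) := fun v => rfl
  unfold ValidContext posR posL
  simp only [hidx, hidx']
  rw [sub_add_eq_add_sub, sub_add_eq_add_sub]
  have hsub : p - b ≠ q - b ↔ p ≠ q := by simp
  rw [hsub]
  refine and_congr_right fun hpq => ?_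
  have key : ∀ x : ZMod n, ∃ w : Prop, (1 ≤ repr1 n x ∧ repr1 n x ≤ n) ∧
      (1 ≤ repr1 n (x + a) ∧ repr1 n (x + a) ≤ n) ∧
      (w → repr1 n (x + a) + n = repr1 n x + a.val) ∧
      (¬ w → repr1 n (x + a) = repr1 n x + a.val) := fun x => by
    refine ⟨repr1 n (x + a) + n = repr1 n x + a.val, ⟨repr1_pos _, repr1_le _⟩,
      ⟨repr1_pos _, repr1_le _⟩, id, fun h => (repr1_add x a).resolve_right h⟩
  have hne : repr1 n (π.symm (p - b)) ≠ repr1 n (π.symm (q - b)) :=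
    (repr1_injective n).ne (π.symm.injective.ne (sub_left_injective.ne hpq))
  have hne' : repr1 n (π.symm (p + 1 - b)) ≠ repr1 n (π.symm (q + 1 - b)) :=
    (repr1_injective n).ne (π.symm.injective.ne
      (sub_left_injective.ne ((add_left_injective 1).ne hpq)))
  obtain ⟨w₁, h₁, h₁', hw₁, hw₁'⟩ := key (π.symm (p - b))
  obtain ⟨w₂, h₂, h₂', hw₂, hw₂'⟩ := key (π.symm (p + 1 - b))
  obtain ⟨v₁, k₁, k₁', hv₁, hv₁'⟩ := key (π.symm (q - b))
  obtain ⟨v₂, k₂, k₂', hv₂, hv₂'⟩ := key (π.symm (q + 1 - b))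
  generalize repr1 n (π.symm (p - b)) = i₁, repr1 n (π.symm (p - b) + a) = i₁',
    repr1 n (π.symm (p + 1 - b)) = i₂, repr1 n (π.symm (p + 1 - b) + a) = i₂',
    repr1 n (π.symm (q - b)) = j₁, repr1 n (π.symm (q - b) + a) = j₁',
    repr1 n (π.symm (q + 1 - b)) = j₂, repr1 n (π.symm (q + 1 - b) + a) = j₂' at *
  refine interleaved_shift (w₁ := w₁) (w₂ := w₂) (v₁ := v₁) (v₂ := v₂)
    ?_ ?_ ?_ ?_ ?_ ?_ ?_ ?_ ?_ ?_ ?_ ?_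
  · omega
  · omega
  · omega
  · omega
  · by_cases w₁ <;> by_cases v₁ <;> simp_all <;> omega
  · omega
  · omega
  · by_cases w₂ <;> by_cases v₂ <;> simp_all <;> omega
  · by_cases w₁ <;> by_cases v₁ <;> simp_all <;> omega
  · by_cases w₁ <;> by_cases v₂ <;> simp_all <;> omega
  · by_cases w₂ <;> by_cases v₁ <;> simp_all <;> omega
  · by_cases w₂ <;> by_cases v₂ <;> simp_all <;> omega

theorem numContexts_phiAct {n : ℕ} [NeZero n] (a b : ZMod n) (π : Equiv.Perm (ZMod n)) :
    numContexts n (phiAct n a b π) = numContexts n π := by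
  unfold numContexts
  congr 1
  let e : ZMod n × ZMod n ≃ ZMod n × ZMod n := (Equiv.subRight b).prodCongr (Equiv.subRight b)
  rw [← Set.ncard_image_of_injective _ e.injective, e.image_eq_preimage_symm]
  congr 1
  ext ⟨p, q⟩
  simp [validContext_phiAct, e]
/-- The cyclic analogue of `Cfun`: it sends `x` to the entry cyclically preceding `x + 1`. -/
def cyclicPred (n : ℕ) (ρ : Equiv.Perm (ZMod n)) (x : ZMod n) : ZMod n :=
  ρ (ρ.symm (x + 1) - 1)

theorem cyclicPred_phiAct {n : ℕ} (a b : ZMod n) (ρ : Equiv.Perm (ZMod n)) (x : ZMod n) :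
    cyclicPred n (phiAct n a b ρ) (x + b) = cyclicPred n ρ x + b := by
  have h : (phiAct n a b ρ).symm (x + b + 1) = ρ.symm (x + 1) + a := by
    rw [Equiv.symm_apply_eq]
    simp [phiAct, Cshift, Tshift]
    ring
  rw [cyclicPred, h]
  simp only [phiAct, Cshift, Tshift, cyclicPred, Equiv.trans_apply, Equiv.subRight_apply,
    Equiv.coe_addRight]
  rw [add_sub_right_comm, add_sub_cancel_right]

theorem isTransitiveMap_cyclicPred_phiAct {n : ℕ} (a b : ZMod n) {ρ : Equiv.Perm (ZMod n)}
    (h : IsTransitiveMap (cyclicPred n ρ)) : IsTransitiveMap (cyclicPred n (phiAct n a b ρ)) :=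
  isTransitiveMap_conj (Equiv.addRight b) (cyclicPred_phiAct a b ρ) h

/-- Deleting the greatest value, which stands at position `m` immediately before `1`, from `π`
gives `ρ`; here `M` is the size of `ρ`. -/
structure IsDeletion (M : ℕ) (ρ : Equiv.Perm (ZMod M)) (π : Equiv.Perm (ZMod (M + 1)))
    (m : ℕ) : Prop where
  one_le : 1 ≤ m
  le : m ≤ M
  apply_max : π (m : ZMod (M + 1)) = 0
  before : ∀ k : ℕ, 1 ≤ k → k < m → repr1 (M + 1) (π k) = repr1 M (ρ k)
  after : ∀ k : ℕ, m ≤ k → k ≤ M → repr1 (M + 1) (π ((k + 1 : ℕ) : ZMod (M + 1))) = repr1 M (ρ k)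
  one : ρ (m : ZMod M) = 1

/-- Values of `ZMod M` embedded into `ZMod (M + 2)` via representatives in `{1, …, M}`. -/
def embTwo (M : ℕ) (x : ZMod M) : ZMod (M + 1 + 1) := (repr1 M x : ZMod (M + 1 + 1))

theorem embTwo_injective (M : ℕ) [NeZero M] : Function.Injective (embTwo M) := fun x y h =>
  repr1_injective M (natCast_injOn ((repr1_le x).trans_lt (by omega))
    ((repr1_le y).trans_lt (by omega)) h)

theorem embTwo_ne_zero {M : ℕ} [NeZero M] (x : ZMod M) : embTwo M x ≠ 0 := fun h => by
  have h1 := repr1_pos x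
  have := natCast_injOn ((repr1_le x).trans_lt (by omega)) (Nat.succ_pos (M + 1))
    (h.trans Nat.cast_zero.symm)
  omega

theorem embTwo_ne_max {M : ℕ} [NeZero M] (x : ZMod M) :
    embTwo M x ≠ ((M + 1 : ℕ) : ZMod (M + 1 + 1)) :=
  fun h => by
  have h1 := repr1_le x
  have := natCast_injOn ((repr1_le x).trans_lt (by omega)) (by omega) h
  omega

theorem eq_zero_or_max_or_embTwo {M : ℕ} [NeZero M] (y : ZMod (M + 1 + 1)) :
    y = 0 ∨ y = ((M + 1 : ℕ) : ZMod (M + 1 + 1)) ∨ ∃ x, y = embTwo M x := by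
  have hlt := ZMod.val_lt y
  by_cases h : y = 0
  · exact .inl h
  have hpos := Nat.pos_of_ne_zero ((ZMod.val_ne_zero y).2 h)
  by_cases h' : y.val = M + 1
  · exact .inr (.inl ((ZMod.natCast_zmod_val y).symm.trans (congrArg _ h')))
  · refine .inr (.inr ⟨(y.val : ZMod M), ?_⟩)
    rw [embTwo, repr1_natCast hpos (by omega), ZMod.natCast_zmod_val]

theorem repr1_add_one {M : ℕ} [NeZero M] {x : ZMod M} (hx : x ≠ 0) :
    repr1 M (x + 1) = repr1 M x + 1 := by
  have hlt := ZMod.val_lt x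
  have h : x + 1 = ((x.val + 1 : ℕ) : ZMod M) := by
    push_cast
    rw [ZMod.natCast_zmod_val]
  rw [h, repr1_natCast (by omega) (by omega), repr1, if_neg hx]

theorem repr1_one {M : ℕ} [NeZero M] : repr1 M 1 = 1 := by
  have := repr1_natCast (n := M) le_rfl (Nat.pos_of_neZero M)
  simpa using this

theorem repr1_zero (M : ℕ) : repr1 M 0 = M := by simp [repr1]

theorem Cfun_eq_listFun_natCast {M : ℕ} (π : Equiv.Perm (ZMod (M + 1))) {i : ℕ} {y : ZMod (M + 1 + 1)}
    (hy : listFun (M + 1) π ((i + 1 : ℕ) : ZMod (M + 1 + 1)) = y + 1) :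
    Cfun (M + 1) π y = listFun (M + 1) π (i : ZMod (M + 1 + 1)) := by
  have h := Cfun_listFun_sub_one π ((i + 1 : ℕ) : ZMod (M + 1 + 1))
  rw [hy, add_sub_cancel_right] at h
  rw [h]
  push_cast
  rw [add_sub_cancel_right]

namespace IsDeletion

variable {M m : ℕ} {ρ : Equiv.Perm (ZMod M)} {π : Equiv.Perm (ZMod (M + 1))}

theorem listFun_before (h : IsDeletion M ρ π m) {k : ℕ} (h1 : 1 ≤ k) (h2 : k < m) :
    listFun (M + 1) π (k : ZMod (M + 1 + 1)) = embTwo M (ρ k) := by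
  have := h.le
  rw [listFun_natCast π h1 (by omega), emb, h.before k h1 h2, embTwo]

theorem listFun_after (h : IsDeletion M ρ π m) {k : ℕ} (h1 : m ≤ k) (h2 : k ≤ M) :
    listFun (M + 1) π ((k + 1 : ℕ) : ZMod (M + 1 + 1)) = embTwo M (ρ k) := by
  rw [listFun_natCast π (by omega) (by omega), emb, h.after k h1 h2, embTwo]

theorem listFun_max (h : IsDeletion M ρ π m) :
    listFun (M + 1) π (m : ZMod (M + 1 + 1)) = ((M + 1 : ℕ) : ZMod (M + 1 + 1)) := by
  have := h.le
  rw [listFun_natCast π h.one_le (by omega), h.apply_max, emb, repr1_zero]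

theorem Cfun_max (h : IsDeletion M ρ π m) :
    Cfun (M + 1) π ((M + 1 : ℕ) : ZMod (M + 1 + 1)) = embTwo M (ρ 0) := by
  have h1 := Cfun_listFun_sub_one π 0
  rw [listFun_zero, zero_sub, ← natCast_self_succ] at h1
  rw [h1, h.listFun_after h.le le_rfl, ZMod.natCast_self]

variable [NeZero M]

theorem Cfun_zero (h : IsDeletion M ρ π m) :
    Cfun (M + 1) π 0 = ((M + 1 : ℕ) : ZMod (M + 1 + 1)) := by
  rw [← h.listFun_max]
  refine Cfun_eq_listFun_natCast π ?_
  rw [h.listFun_after le_rfl h.le, h.one, embTwo, repr1_one]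
  simp

/-- `cyclicPred` is the first return map of `Cfun` to the values different from `0` and the
maximum. -/
theorem Cfun_embTwo (h : IsDeletion M ρ π m) (x : ZMod M) :
    Cfun (M + 1) π (embTwo M x) = embTwo M (cyclicPred M ρ x) ∨
      (Cfun (M + 1) π (embTwo M x) = 0 ∧ cyclicPred M ρ x = ρ 0) := by
  obtain ⟨i, hi1, hiM, hi⟩ : ∃ i : ℕ, i + 1 ≥ 1 ∧ i + 1 ≤ M ∧
      ρ.symm (x + 1) = ((i + 1 : ℕ) : ZMod M) := by
    have h1 := repr1_pos (ρ.symm (x + 1))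
    have h2 := repr1_le (ρ.symm (x + 1))
    refine ⟨repr1 M (ρ.symm (x + 1)) - 1, by omega, by omega, ?_⟩
    rw [Nat.sub_add_cancel h1, cast_repr1]
  have hD : cyclicPred M ρ x = ρ (i : ZMod M) := by
    rw [cyclicPred, hi]
    push_cast
    rw [add_sub_cancel_right]
  have hx : ρ ((i + 1 : ℕ) : ZMod M) = x + 1 := by rw [← hi, ρ.apply_symm_apply]
  have hm1 := h.one_le
  have hmM := h.le
  have hstep : i + 1 ≠ m → embTwo M (x + 1) = embTwo M x + 1 := fun hne => by
    have hx0 : x ≠ 0 := by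
      rintro rfl
      rw [zero_add, ← h.one] at hx
      apply hne
      rw [← repr1_natCast hi1 hiM, ρ.injective hx, repr1_natCast hm1 hmM]
    rw [embTwo, repr1_add_one hx0]
    push_cast
    rfl
  have hlow : i < m → Cfun (M + 1) π (embTwo M x) = listFun (M + 1) π (i : ZMod (M + 1 + 1)) →
      Cfun (M + 1) π (embTwo M x) = embTwo M (cyclicPred M ρ x) ∨
      (Cfun (M + 1) π (embTwo M x) = 0 ∧ cyclicPred M ρ x = ρ 0) := fun him hC => by
    rcases Nat.eq_zero_or_pos i with rfl | hpos
    · right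
      rw [hC, hD, Nat.cast_zero, Nat.cast_zero, listFun_zero]
      exact ⟨rfl, rfl⟩
    · left
      rw [hC, hD, h.listFun_before hpos him]
  rcases lt_trichotomy (i + 1) m with him | him | him
  · refine hlow (by omega) (Cfun_eq_listFun_natCast π ?_)
    rw [h.listFun_before hi1 him, hx, hstep him.ne]
  · refine hlow (by omega) (Cfun_eq_listFun_natCast π ?_)
    have hx0 : x = 0 := by
      rw [him, h.one] at hx
      simpa using hx.symm
    rw [him, h.listFun_max, hx0, embTwo, repr1_zero]
    push_cast
    rfl
  · left
    have hC : Cfun (M + 1) π (embTwo M x) =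
        listFun (M + 1) π ((i + 1 : ℕ) : ZMod (M + 1 + 1)) := by
      refine Cfun_eq_listFun_natCast π ?_
      rw [h.listFun_after him.le hiM, hx, hstep him.ne']
    rw [hC, hD, h.listFun_after (by omega) (by omega)]

theorem isTransitiveMap_iff (h : IsDeletion M ρ π m) :
    IsTransitiveMap (Cfun (M + 1) π) ↔ IsTransitiveMap (cyclicPred M ρ) := by
  constructor
  · intro htr S ⟨s, hs⟩ hS
    have := htr (embTwo M '' S ∪ {y | (y = 0 ∨ y = ((M + 1 : ℕ) : ZMod (M + 1 + 1))) ∧ ρ 0 ∈ S})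
      ⟨_, .inl ⟨s, hs, rfl⟩⟩ (by
        rintro _ (⟨x, hx, rfl⟩ | ⟨rfl | rfl, h0⟩)
        · rcases h.Cfun_embTwo x with hC | ⟨hC, hD⟩
          · exact .inl ⟨_, hS hx, hC.symm⟩
          · exact .inr ⟨.inl hC, hD ▸ hS hx⟩
        · exact .inr ⟨.inr h.Cfun_zero, h0⟩
        · exact .inl ⟨_, h0, h.Cfun_max.symm⟩)
    rw [Set.eq_univ_iff_forall] at this ⊢
    intro x
    rcases this (embTwo M x) with ⟨y, hy, hxy⟩ | ⟨h0 | h0, -⟩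
    · exact embTwo_injective M hxy ▸ hy
    · exact absurd h0 (embTwo_ne_zero x)
    · exact absurd h0 (embTwo_ne_max x)
  · intro htr T ⟨t, ht⟩ hT
    have h0max : (0 : ZMod (M + 1 + 1)) ∈ T → ((M + 1 : ℕ) : ZMod (M + 1 + 1)) ∈ T := fun h0 =>
      h.Cfun_zero ▸ hT h0
    have hmax : ((M + 1 : ℕ) : ZMod (M + 1 + 1)) ∈ T → embTwo M (ρ 0) ∈ T := fun hm =>
      h.Cfun_max ▸ hT hm
    have hS := htr (embTwo M ⁻¹' T)
      (by
        rcases eq_zero_or_max_or_embTwo t with rfl | rfl | ⟨x, rfl⟩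
        · exact ⟨_, hmax (h0max ht)⟩
        · exact ⟨_, hmax ht⟩
        · exact ⟨x, ht⟩)
      (fun x hx => by
        rcases h.Cfun_embTwo x with hC | ⟨hC, hD⟩
        · rw [Set.mem_preimage, ← hC]
          exact hT hx
        · rw [Set.mem_preimage, hD]
          exact hmax (h0max (hC ▸ hT hx)))
    rw [Set.eq_univ_iff_forall] at hS ⊢
    have hzero : (0 : ZMod (M + 1 + 1)) ∈ T := by
      obtain ⟨y, hy⟩ := Cfun_surjective π 0
      rcases eq_zero_or_max_or_embTwo y with rfl | rfl | ⟨x, rfl⟩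
      · exact absurd (h.Cfun_zero.symm.trans hy) natCast_self_succ_ne_zero
      · exact absurd (h.Cfun_max.symm.trans hy) (embTwo_ne_zero _)
      · exact hy ▸ hT (hS x)
    intro y
    rcases eq_zero_or_max_or_embTwo y with rfl | rfl | ⟨x, rfl⟩
    · exact hzero
    · exact h0max hzero
    · exact hS x

end IsDeletion

/-- Every permutation arises by deleting the maximum from a permutation in which the maximum
immediately precedes `1`. -/
theorem exists_isDeletion {M : ℕ} [NeZero M] (ρ : Equiv.Perm (ZMod M)) :
    ∃ (π : Equiv.Perm (ZMod (M + 1))) (m : ℕ), IsDeletion M ρ π m := by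
  set m := repr1 M (ρ.symm 1) with hm
  have hm1 : 1 ≤ m := repr1_pos _
  have hmM : m ≤ M := repr1_le _
  let f : ℕ → ZMod (M + 1) := fun i =>
    if i < m then emb M (ρ i) else if i = m then 0 else emb M (ρ ((i - 1 : ℕ) : ZMod M))
  have hinj : Function.Injective fun x : ZMod (M + 1) => f (repr1 (M + 1) x) := by
    intro x y hxy
    apply repr1_injective
    have hx := repr1_pos x
    have hx' := repr1_le x
    have hy := repr1_pos y
    have hy' := repr1_le y
    have hρ : ∀ i j : ℕ, 1 ≤ i → i ≤ M → 1 ≤ j → j ≤ M →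
        emb M (ρ i) = emb M (ρ j) → i = j := fun i j h1 h2 h3 h4 he => by
      rw [← repr1_natCast h1 h2, ρ.injective (emb_injective M he), repr1_natCast h3 h4]
    simp only [f] at hxy
    split_ifs at hxy with h1 h2 h3 h4 h5 h6 h7 h8
    all_goals first
      | omega
      | exact absurd hxy (emb_ne_zero _)
      | exact absurd hxy.symm (emb_ne_zero _)
      | (have := hρ _ _ (by omega) (by omega) (by omega) (by omega) hxy; omega)
  refine ⟨Equiv.ofBijective _ (Finite.injective_iff_bijective.1 hinj), m, hm1, hmM, ?_, ?_, ?_, ?_⟩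
  · rw [Equiv.ofBijective_apply, repr1_natCast hm1 (by omega)]
    simp [f]
  · intro k h1 h2
    rw [Equiv.ofBijective_apply, repr1_natCast h1 (by omega)]
    simp only [f, if_pos h2]
    exact repr1_natCast (repr1_pos _) ((repr1_le _).trans (by omega))
  · intro k h1 h2
    rw [Equiv.ofBijective_apply, repr1_natCast (by omega) (by omega)]
    simp only [f, if_neg (show ¬ k + 1 < m by omega), if_neg (show ¬ k + 1 = m by omega),
      Nat.add_sub_cancel]
    exact repr1_natCast (repr1_pos _) ((repr1_le _).trans (by omega))
  · rw [hm, cast_repr1, ρ.apply_symm_apply]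

theorem mem_MsetAll_iff {n : ℕ} (hn : 0 < n) (ρ : Equiv.Perm (ZMod (2 * n - 1))) :
    ρ ∈ MsetAll n ↔ IsTransitiveMap (cyclicPred (2 * n - 1) ρ) := by
  have hev : Even (2 * n) := even_two_mul n
  have h2 : 2 ≤ 2 * n := by omega
  have hM : 2 * n = 2 * n - 1 + 1 := by omega
  have hM0 : 2 * n - 1 ≠ 0 := by omega
  unfold MsetAll IsContraction
  rw [Set.mem_ofPred_eq]
  generalize 2 * n - 1 = M at *
  generalize 2 * n = N at *
  subst hM
  have : NeZero M := ⟨hM0⟩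
  constructor
  · rintro ⟨π, hπ, m, h1, hm, hmax, hbefore, hafter⟩
    rw [maxPile_iff h2 hev] at hπ
    obtain ⟨h0, htr⟩ := hπ
    rw [ZMod.natCast_self] at hmax
    have hlm : listFun (M + 1) π (m : ZMod (M + 1 + 1)) = ((M + 1 : ℕ) : ZMod (M + 1 + 1)) := by
      rw [listFun_natCast π h1 hm, hmax, emb, repr1_zero]
    have hl : listFun (M + 1) π ((m + 1 : ℕ) : ZMod (M + 1 + 1)) = 1 := by
      obtain ⟨j, hj⟩ := listFun_surjective π 1
      have hC := Cfun_listFun_sub_one π j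
      rw [hj, sub_self, h0, ← hlm] at hC
      rw [← hj]
      congr 1
      push_cast
      rw [listFun_injective π hC, sub_add_cancel]
    have hmM : m ≤ M := by
      by_contra hlt
      obtain rfl : m = M + 1 := by omega
      rw [ZMod.natCast_self, listFun_zero] at hl
      have := natCast_injOn (n := M + 1 + 1) (i := 0) (j := 1) (by omega) (by omega)
        (by exact_mod_cast hl)
      omega
    have hrepr : ∀ i : ℕ, 1 ≤ i → i ≤ M + 1 → i ≠ m → repr1 (M + 1) (π i) ≤ M :=
      fun i hi hi' hne => by
      have hle := repr1_le (π i)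
      by_contra hlt
      have he : repr1 (M + 1) (π i) = repr1 (M + 1) (π m) := by
        rw [hmax, repr1_zero]
        omega
      apply hne
      rw [← repr1_natCast hi hi', π.injective (repr1_injective _ he), repr1_natCast h1 hm]
    have hdel : IsDeletion M ρ π m := by
      refine ⟨h1, hmM, hmax, fun k hk hk' => ?_, fun k hk hk' => ?_, ?_⟩
      · rw [hbefore k hk hk', repr1_natCast (repr1_pos _) (hrepr k hk (by omega) (by omega))]
      · rw [hafter k hk hk',
          repr1_natCast (repr1_pos _) (hrepr (k + 1) (by omega) (by omega) (by omega))]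
      · rw [listFun_natCast π (by omega) (by omega), emb] at hl
        rw [hafter m le_rfl hmM, natCast_injOn (j := 1) ((repr1_le _).trans_lt (by omega))
          (by omega) (hl.trans Nat.cast_one.symm), Nat.cast_one]
    exact hdel.isTransitiveMap_iff.1 htr
  · intro htr
    obtain ⟨π, m, hdel⟩ := exists_isDeletion ρ
    have hmM := hdel.le
    refine ⟨π, (maxPile_iff h2 hev π).2 ⟨hdel.Cfun_zero, hdel.isTransitiveMap_iff.2 htr⟩, m,
      hdel.one_le, by omega, ?_, fun k hk hk' => ?_, fun k hk hk' => ?_⟩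
    · rw [hdel.apply_max, ZMod.natCast_self]
    · rw [hdel.before k hk hk', cast_repr1]
    · rw [hdel.after k hk hk', cast_repr1]

/-- For every `a, b ∈ Z_{2n-1}` and every `π ∈ M_{2n,k}`, the permutation
`φ(a,b,π)` is again an element of `M_{2n,k}`. -/
theorem stmt3 (n k : ℕ) (hn : 0 < n) (a b : ZMod (2 * n - 1))
    (π : Equiv.Perm (ZMod (2 * n - 1))) (hπ : π ∈ Mset n k) :
    phiAct (2 * n - 1) a b π ∈ Mset n k := by
  have : NeZero (2 * n - 1) := ⟨by omega⟩
  obtain ⟨hmem, hk⟩ := hπ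
  refine ⟨?_, (numContexts_phiAct a b π).trans hk⟩
  rw [mem_MsetAll_iff hn] at hmem ⊢
  exact isTransitiveMap_cyclicPred_phiAct a b hmem
end

section
/- Let π ∈ M_{2n,k}. If the difference sequence D_π is periodic with period p, then the orbit O_π of π under the action φ′ of Z_{2n−1} × Z_{2n−1} has cardinality (2n−1)·p; if D_π is not periodic, then |O_π| = (2n−1)². -/
theorem phiAct_apply (N : ℕ) (a b : ZMod N) (π : Equiv.Perm (ZMod N)) (x : ZMod N) :
    phiAct N a b π x = π (x - a) + b := rfl

/-- A function on `ZMod N` that is invariant under `x ↦ x + 1` is constant. -/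
theorem eq_apply_zero_of_add_one {N : ℕ} [NeZero N] {α : Type*} (f : ZMod N → α)
    (hf : ∀ x, f (x + 1) = f x) (x : ZMod N) : f x = f 0 := by
  have h : ∀ m : ℕ, f (m : ZMod N) = f 0 := by
    intro m
    induction m with
    | zero => simp
    | succ m ih => rw [Nat.cast_succ, hf, ih]
  simpa using h x.val

/-- If the difference sequence of `π` is invariant under a shift by `p`, then shifting the
argument of `π` by a multiple of `p` translates `π`. -/
theorem exists_apply_add_mul {N : ℕ} [NeZero N] (π : Equiv.Perm (ZMod N)) (p : ZMod N)
    (hp : ∀ k, Dseq N π (k + p) = Dseq N π k) :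
    ∃ c : ZMod N, ∀ (j : ℕ) (x : ZMod N), π (x + j * p) = π x + j * c := by
  refine ⟨π (0 + p) - π 0, fun j => ?_⟩
  have hc : ∀ x, π (x + p) - π x = π (0 + p) - π 0 := by
    refine eq_apply_zero_of_add_one (fun x => π (x + p) - π x) fun x => ?_
    have h := hp x
    simp only [Dseq] at h
    rw [add_right_comm x 1 p]
    linear_combination h
  induction j with
  | zero => simp
  | succ j ih =>
    intro x
    have h1 : x + ((j + 1 : ℕ) : ZMod N) * p = (x + p) + j * p := by push_cast; ring
    rw [h1, ih, Nat.cast_succ]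
    linear_combination hc x

/-- If `phiAct` takes the same value at the shifts `a ≤ a'`, then the difference sequence is
invariant under a shift by `a' - a`. -/
theorem Dseq_add_of_phiAct_eq {N : ℕ} {π : Equiv.Perm (ZMod N)} {a a' : ℕ} {b b' : ZMod N}
    (haa' : a ≤ a') (h : phiAct N a b π = phiAct N a' b' π) (k : ZMod N) :
    Dseq N π (k + ((a' - a : ℕ) : ZMod N)) = Dseq N π k := by
  have key : ∀ k : ZMod N, π (k + ((a' - a : ℕ) : ZMod N)) + b = π k + b' := by
    intro k
    have h1 := Equiv.congr_fun h (k + a')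
    rw [phiAct_apply, phiAct_apply] at h1
    rwa [Nat.cast_sub haa', ← add_sub_assoc, ← add_sub_cancel_right k (a' : ZMod N),
      sub_add_cancel]
  have h1 := key (k + 1)
  rw [add_right_comm] at h1
  simp only [Dseq]
  linear_combination h1 - key k

/-- The orbit of `π` has `N * p` elements, where `p` is the least positive shift leaving the
difference sequence of `π` invariant. -/
theorem ncard_orbit_phiAct {N : ℕ} [NeZero N] (π : Equiv.Perm (ZMod N)) (p : ℕ) (hp0 : 0 < p)
    (hp : ∀ k, Dseq N π (k + (p : ZMod N)) = Dseq N π k)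
    (hmin : ∀ q : ℕ, 0 < q → q < p → ¬ ∀ k, Dseq N π (k + (q : ZMod N)) = Dseq N π k) :
    {σ : Equiv.Perm (ZMod N) | ∃ a b : ZMod N, phiAct N a b π = σ}.ncard = N * p := by
  let f : Fin p × ZMod N → Equiv.Perm (ZMod N) := fun x => phiAct N ((x.1 : ℕ) : ZMod N) x.2 π
  have hf : Function.Injective f := by
    rintro ⟨a, b⟩ ⟨a', b'⟩ (h : phiAct N ((a : ℕ) : ZMod N) b π = phiAct N ((a' : ℕ) : ZMod N) b' π)
    have haa' : a = a' := by
      rcases lt_trichotomy (a : ℕ) (a' : ℕ) with hlt | heq | hlt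
      · exact absurd (Dseq_add_of_phiAct_eq hlt.le h) (hmin _ (by omega) (by omega))
      · exact Fin.ext heq
      · exact absurd (Dseq_add_of_phiAct_eq hlt.le h.symm) (hmin _ (by omega) (by omega))
    subst haa'
    have h0 := Equiv.congr_fun h 0
    rw [phiAct_apply, phiAct_apply] at h0
    rw [add_left_cancel h0]
  have hrange : {σ : Equiv.Perm (ZMod N) | ∃ a b : ZMod N, phiAct N a b π = σ} = Set.range f := by
    ext σ
    constructor
    · rintro ⟨a, b, rfl⟩
      obtain ⟨c, hc⟩ := exists_apply_add_mul π p hp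
      refine ⟨(⟨a.val % p, Nat.mod_lt _ hp0⟩, b - (a.val / p : ℕ) * c), Equiv.ext fun x => ?_⟩
      have ha : a = ((a.val % p : ℕ) : ZMod N) + ((a.val / p : ℕ) : ZMod N) * (p : ZMod N) := by
        conv_lhs => rw [← ZMod.natCast_zmod_val a, ← Nat.mod_add_div' a.val p]
        push_cast
        rfl
      have h1 := hc (a.val / p) (x - a)
      have h2 : x - a + ((a.val / p : ℕ) : ZMod N) * (p : ZMod N)
          = x - ((a.val % p : ℕ) : ZMod N) := by
        linear_combination -ha
      rw [h2] at h1
      change π (x - ((a.val % p : ℕ) : ZMod N)) + (b - (a.val / p : ℕ) * c) = π (x - a) + b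
      linear_combination h1
    · rintro ⟨x, rfl⟩
      exact ⟨_, _, rfl⟩
  rw [hrange, ← Set.image_univ, Set.ncard_image_of_injective _ hf, Set.ncard_univ,
    Nat.card_prod, Nat.card_fin, Nat.card_zmod, mul_comm]

/-- For `π ∈ M_{2n,k}`: if `D_π` is periodic with period `p` then the orbit
of `π` under the `Z_{2n-1} × Z_{2n-1}`-action `φ` has cardinality `(2n-1)·p`; if `D_π` is
not periodic then the orbit has cardinality `(2n-1)²`. -/
theorem stmt6 (n k : ℕ) (hn : 0 < n) (π : Equiv.Perm (ZMod (2 * n - 1)))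
    (hπ : π ∈ Mset n k) :
    (∀ p : ℕ, PeriodicWith (2 * n - 1) π p →
      {σ : Equiv.Perm (ZMod (2 * n - 1)) |
        ∃ a b : ZMod (2 * n - 1), phiAct (2 * n - 1) a b π = σ}.ncard = (2 * n - 1) * p) ∧
    ((¬ ∃ p : ℕ, PeriodicWith (2 * n - 1) π p) →
      {σ : Equiv.Perm (ZMod (2 * n - 1)) |
        ∃ a b : ZMod (2 * n - 1), phiAct (2 * n - 1) a b π = σ}.ncard = (2 * n - 1) ^ 2) := by
  have : NeZero (2 * n - 1) := ⟨by omega⟩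
  refine ⟨fun p hp => ncard_orbit_phiAct π p hp.1 hp.2.2.1 hp.2.2.2, fun hnot => ?_⟩
  rw [sq]
  refine ncard_orbit_phiAct π _ (by omega) (fun k => by simp) fun q hq0 hqN hq => hnot ?_
  classical
  have hex : ∃ q : ℕ, 0 < q ∧
      ∀ k, Dseq (2 * n - 1) π (k + (q : ZMod (2 * n - 1))) = Dseq (2 * n - 1) π k :=
    ⟨q, hq0, hq⟩
  refine ⟨Nat.find hex, (Nat.find_spec hex).1, (Nat.find_min' hex ⟨hq0, hq⟩).trans_lt hqN,
    (Nat.find_spec hex).2, fun r hr0 hr h => Nat.find_min hex hr ⟨hr0, h⟩⟩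
end

section
/- An n-tuple E ∈ (Z_n)^n is the difference sequence of some permutation in S_n if and only if Σ_{i=1}^{n} E(i) = 0 in Z_n and there exist no i ∈ {1,…,n} and j ∈ {1,…,n−1} such that Σ_{k=0}^{j−1} E(i+k) = 0 in Z_n (indices of E read modulo n). -/
theorem sum_range_natCast_zmod {M : Type*} [AddCommMonoid M] (n : ℕ) [NeZero n]
    (f : ZMod n → M) : ∑ k ∈ Finset.range n, f (k : ZMod n) = ∑ x : ZMod n, f x := by
  refine Finset.sum_bij (fun k _ => (k : ZMod n)) (by simp) ?_ ?_ (by simp)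
  · intro a ha b hb hab
    have h := congrArg ZMod.val hab
    simpa [ZMod.val_natCast, Nat.mod_eq_of_lt (Finset.mem_range.1 ha),
      Nat.mod_eq_of_lt (Finset.mem_range.1 hb)] using h
  · intro x _
    exact ⟨x.val, Finset.mem_range.2 (ZMod.val_lt x), ZMod.natCast_zmod_val x⟩

theorem sum_range_Dseq (n : ℕ) (π : Equiv.Perm (ZMod n)) (i : ZMod n) (j : ℕ) :
    ∑ k ∈ Finset.range j, Dseq n π (i + (k : ZMod n)) = π (i + (j : ZMod n)) - π i := by
  have h := Finset.sum_range_sub (fun k : ℕ => π (i + (k : ZMod n))) j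
  simpa [Dseq, add_assoc] using h

theorem sum_Dseq (n : ℕ) [NeZero n] (π : Equiv.Perm (ZMod n)) :
    ∑ k : ZMod n, Dseq n π k = 0 := by
  simp only [Dseq, Finset.sum_sub_distrib]
  rw [sub_eq_zero]
  exact Equiv.sum_comp (Equiv.addRight (1 : ZMod n)) π

/-- The sum of the entries of `E` at the positions `0, …, x - 1`. -/
def partialSum (n : ℕ) (E : ZMod n → ZMod n) (x : ZMod n) : ZMod n :=
  ∑ k ∈ Finset.range x.val, E (k : ZMod n)

theorem partialSum_add_one_sub (n : ℕ) [NeZero n] (E : ZMod n → ZMod n)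
    (hE : ∑ i : ZMod n, E i = 0) (x : ZMod n) :
    partialSum n E (x + 1) - partialSum n E x = E x := by
  have hs : ∑ k ∈ Finset.range (x.val + 1), E (k : ZMod n) = partialSum n E x + E x := by
    rw [Finset.sum_range_succ, ZMod.natCast_zmod_val, partialSum]
  have hcast : x + 1 = ((x.val + 1 : ℕ) : ZMod n) := by
    rw [Nat.cast_add, ZMod.natCast_zmod_val, Nat.cast_one]
  have hp : partialSum n E (x + 1) = ∑ k ∈ Finset.range (x.val + 1), E (k : ZMod n) := by
    rcases Nat.lt_or_ge (x.val + 1) n with h | h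
    · rw [partialSum, hcast, ZMod.val_natCast, Nat.mod_eq_of_lt h]
    · have hn : x.val + 1 = n := le_antisymm (ZMod.val_lt x) h
      have h0 : x + 1 = 0 := by rw [hcast, hn, ZMod.natCast_self]
      rw [hn, sum_range_natCast_zmod, hE, h0]
      simp [partialSum]
  rw [hp, hs, add_sub_cancel_left]

theorem partialSum_ne_of_val_lt (n : ℕ) [NeZero n] (E : ZMod n → ZMod n)
    (hE : ¬ ∃ (i : ZMod n) (j : ℕ), 1 ≤ j ∧ j ≤ n - 1 ∧
      ∑ k ∈ Finset.range j, E (i + (k : ZMod n)) = 0)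
    {a b : ZMod n} (hab : a.val < b.val) : partialSum n E a ≠ partialSum n E b := by
  intro h
  have hb := ZMod.val_lt b
  refine hE ⟨a, b.val - a.val, by omega, by omega, ?_⟩
  have hsplit := Finset.sum_range_add (fun k : ℕ => E (k : ZMod n)) a.val (b.val - a.val)
  rw [Nat.add_sub_cancel' hab.le] at hsplit
  simp only [partialSum] at h
  rw [← h, left_eq_add] at hsplit
  simpa using hsplit

theorem partialSum_injective (n : ℕ) [NeZero n] (E : ZMod n → ZMod n)
    (hE : ¬ ∃ (i : ZMod n) (j : ℕ), 1 ≤ j ∧ j ≤ n - 1 ∧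
      ∑ k ∈ Finset.range j, E (i + (k : ZMod n)) = 0) :
    Function.Injective (partialSum n E) := by
  intro a b h
  rcases lt_trichotomy a.val b.val with hab | hab | hab
  · exact absurd h (partialSum_ne_of_val_lt n E hE hab)
  · exact ZMod.val_injective n hab
  · exact absurd h.symm (partialSum_ne_of_val_lt n E hE hab)

/-- An `n`-tuple `E ∈ (Z_n)^n` is the difference sequence of some
permutation in `S_n` iff `Σ_{i=1}^{n} E(i) = 0` and there are no `i ∈ {1,…,n}` and
`j ∈ {1,…,n-1}` with `Σ_{k=0}^{j-1} E(i+k) = 0`. -/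
theorem stmt7 (n : ℕ) [NeZero n] (E : ZMod n → ZMod n) :
    (∃ π : Equiv.Perm (ZMod n), ∀ k : ZMod n, Dseq n π k = E k) ↔
    ((∑ i : ZMod n, E i) = 0 ∧
      ¬ ∃ (i : ZMod n) (j : ℕ), 1 ≤ j ∧ j ≤ n - 1 ∧
        (∑ k ∈ Finset.range j, E (i + (k : ZMod n))) = 0) := by
  constructor
  · rintro ⟨π, hπ⟩
    obtain rfl : Dseq n π = E := funext hπ
    refine ⟨sum_Dseq n π, ?_⟩
    rintro ⟨i, j, hj1, hjn, h⟩
    rw [sum_range_Dseq, sub_eq_zero, π.apply_eq_iff_eq, add_eq_left,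
      ZMod.natCast_eq_zero_iff] at h
    have := Nat.le_of_dvd hj1 h
    omega
  · rintro ⟨hsum, hE⟩
    exact ⟨Equiv.ofBijective (partialSum n E)
      (Finite.injective_iff_bijective.1 (partialSum_injective n E hE)),
      partialSum_add_one_sub n E hsum⟩
end
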